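/- Let p > 3 be a prime. Then, with congruences interpreted in ℤ/pℤ: (i) ∑_{k=0}^{⌊p/4⌋} C(4k,2k)/16^k ≡ (1/2)·(2|p) (mod p), where (2|p) is the Legendre symbol; (ii) ∑_{k=0}^{⌊p/4⌋} C(4k,2k)/4^k ≡ (−1)^{(p−1)/2} (mod p) if p ≡ 1 (mod 3), and ≡ 0 (mod p) if p ≡ 2 (mod 3); (iii) ∑_{k=0}^{⌊p/4⌋} C(4k,2k)/64^k ≡ 0 (mod p) if p ≡ 5,7,17,19 (mod 24), ≡ 1 (mod p) if p ≡ 1,23 (mod 24), and ≡ −1 (mod p) if p ≡ 11,13 (mod 24). -/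

import Mathlib

/-- For `p = 2 * n + 1` prime and `j ≤ n`, the central binomial coefficient is `(-4) ^ j * n.choose j`
modulo `p`. -/
theorem centralBinom_eq_neg_four_pow_mul_choose {p n : ℕ} [Fact p.Prime] (hn : p = 2 * n + 1) {j : ℕ}
    (hj : j ≤ n) : (Nat.centralBinom j : ZMod p) = (-4) ^ j * (n.choose j : ZMod p) := by
  induction j with
  | zero => simp
  | succ j ih =>
    have hj0 : ((j : ZMod p) + 1) ≠ 0 := by
      intro h
      have h' : ((j + 1 : ℕ) : ZMod p) = 0 := by exact_mod_cast h
      rw [ZMod.natCast_eq_zero_iff] at h'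
      have := Nat.le_of_dvd (by omega) h'
      omega
    have hp0 : (2 * (n : ZMod p) + 1) = 0 := by
      have h : ((2 * n + 1 : ℕ) : ZMod p) = 0 := by rw [← hn]; exact ZMod.natCast_self p
      exact_mod_cast h
    have hcb := congrArg (Nat.cast : ℕ → ZMod p) (Nat.succ_mul_centralBinom_succ j)
    have hch := congrArg (Nat.cast : ℕ → ZMod p) (Nat.choose_succ_right_eq n j)
    push_cast [Nat.cast_sub (show j ≤ n by omega)] at hcb hch
    rw [ih (by omega)] at hcb
    apply mul_left_cancel₀ hj0
    rw [hcb, pow_succ]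
    linear_combination (-4) ^ j * 4 * hch + 2 * (-4) ^ j * (n.choose j : ZMod p) * hp0

theorem sum_range_two_mul_eq_sum_add {M : Type*} [AddCommMonoid M] (f : ℕ → M) (m : ℕ) :
    ∑ j ∈ Finset.range (2 * m), f j = ∑ k ∈ Finset.range m, (f (2 * k) + f (2 * k + 1)) := by
  induction m with
  | zero => simp
  | succ m ih =>
    rw [Nat.mul_succ, Finset.sum_range_succ, Finset.sum_range_succ, Finset.sum_range_succ, ih,
      add_assoc]

theorem two_mul_sum_choose_even {R : Type*} [CommRing R] (n : ℕ) (x : R) :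
    2 * ∑ k ∈ Finset.range (n / 2 + 1), (n.choose (2 * k) : R) * x ^ (2 * k)
      = (1 + x) ^ n + (1 - x) ^ n := by
  have expand (y : R) : (1 + y) ^ n
      = ∑ k ∈ Finset.range (n / 2 + 1), ((n.choose (2 * k) : R) * y ^ (2 * k)
        + (n.choose (2 * k + 1) : R) * y ^ (2 * k + 1)) := by
    rw [← sum_range_two_mul_eq_sum_add (fun j => (n.choose j : R) * y ^ j), add_comm, add_pow]
    refine (Finset.sum_congr rfl fun j _ => by ring).trans
      (Finset.sum_subset (Finset.range_subset_range.2 (by omega)) fun j _ hj => ?_)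
    rw [Finset.mem_range, Nat.lt_succ_iff, not_le] at hj
    rw [Nat.choose_eq_zero_of_lt hj]
    simp
  rw [sub_eq_add_neg, expand x, expand (-x), ← Finset.sum_add_distrib, Finset.mul_sum]
  refine Finset.sum_congr rfl fun k _ => ?_
  rw [(even_two_mul k).neg_pow, (odd_two_mul_add_one k).neg_pow]
  ring

theorem two_mul_sum_choose_four_mul {p : ℕ} [Fact p.Prime] (hp : p ≠ 2) {m x : ZMod p} (hm : m ≠ 0)
    (hx : x ^ 2 * m = 16) :
    2 * ∑ k ∈ Finset.range (p / 4 + 1), (Nat.choose (4 * k) (2 * k) : ZMod p) / m ^ k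
      = (1 + x) ^ (p / 2) + (1 - x) ^ (p / 2) := by
  have hodd := (Fact.out : p.Prime).eq_two_or_odd.resolve_left hp
  rw [← two_mul_sum_choose_even, Nat.div_div_eq_div_mul]
  congr 1
  refine Finset.sum_congr rfl fun k hk => ?_
  rw [Finset.mem_range] at hk
  have h := centralBinom_eq_neg_four_pow_mul_choose (p := p) (n := p / 2) (by omega)
    (show 2 * k ≤ p / 2 by omega)
  rw [Nat.centralBinom_eq_two_mul_choose, ← mul_assoc, pow_mul] at h
  rw [div_eq_iff (pow_ne_zero _ hm), pow_mul, mul_assoc, ← mul_pow, hx]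
  norm_num at h ⊢
  rw [h, mul_comm]

theorem three_pow_half {p : ℕ} [Fact p.Prime] (hp : 3 < p) :
    (3 : ZMod p) ^ (p / 2) = (-1) ^ (p / 2) * (legendreSym 3 p : ZMod p) := by
  have h := legendreSym.quadratic_reciprocity' (p := 3) (q := p) (by norm_num) (by omega)
  have h3 := legendreSym.eq_pow p 3
  rw [show ((3 : ℤ)) = ((3 : ℕ) : ℤ) from rfl, h] at h3
  push_cast at h3
  simpa using h3.symm

theorem ZMod.two_ne_zero_of_ne_two {p : ℕ} [Fact p.Prime] (hp : p ≠ 2) : (2 : ZMod p) ≠ 0 := by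
  have : ((2 : ℕ) : ZMod p) ≠ 0 := by
    rw [Ne, ZMod.natCast_eq_zero_iff, Nat.prime_dvd_prime_iff_eq Fact.out Nat.prime_two]
    exact hp
  exact_mod_cast this

theorem two_pow_half {p : ℕ} [Fact p.Prime] (hp : p ≠ 2) :
    (2 : ZMod p) ^ (p / 2) = if p % 8 = 1 ∨ p % 8 = 7 then 1 else -1 := by
  have h2 : (2 : ZMod p) ≠ 0 := ZMod.two_ne_zero_of_ne_two hp
  split_ifs with h
  · exact (ZMod.euler_criterion p h2).1 ((ZMod.exists_sq_eq_two_iff hp).2 h)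
  · exact (ZMod.pow_div_two_eq_neg_one_or_one p h2).resolve_left
      fun h' => h ((ZMod.exists_sq_eq_two_iff hp).1 ((ZMod.euler_criterion p h2).2 h'))

theorem legendreSym_three_of_mod_eq_one {p : ℕ} (h : p % 3 = 1) : legendreSym 3 p = 1 := by
  rw [legendreSym.mod, show (p : ℤ) % (3 : ℕ) = 1 by omega]
  decide

theorem legendreSym_three_of_mod_eq_two {p : ℕ} (h : p % 3 = 2) : legendreSym 3 p = -1 := by
  rw [legendreSym.mod, show (p : ℤ) % (3 : ℕ) = 2 by omega]
  decide

theorem stmt1 (p : ℕ) [Fact p.Prime] (hp : 3 < p) :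
    ((∑ k ∈ Finset.range (p / 4 + 1),
        (Nat.choose (4 * k) (2 * k) : ZMod p) / 16 ^ k)
      = (1 / 2) * (legendreSym p 2 : ZMod p)) ∧
    (p % 3 = 1 →
      (∑ k ∈ Finset.range (p / 4 + 1),
          (Nat.choose (4 * k) (2 * k) : ZMod p) / 4 ^ k)
        = (-1 : ZMod p) ^ ((p - 1) / 2)) ∧
    (p % 3 = 2 →
      (∑ k ∈ Finset.range (p / 4 + 1),
          (Nat.choose (4 * k) (2 * k) : ZMod p) / 4 ^ k) = 0) ∧
    (p % 24 = 5 ∨ p % 24 = 7 ∨ p % 24 = 17 ∨ p % 24 = 19 →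
      (∑ k ∈ Finset.range (p / 4 + 1),
          (Nat.choose (4 * k) (2 * k) : ZMod p) / 64 ^ k) = 0) ∧
    (p % 24 = 1 ∨ p % 24 = 23 →
      (∑ k ∈ Finset.range (p / 4 + 1),
          (Nat.choose (4 * k) (2 * k) : ZMod p) / 64 ^ k) = 1) ∧
    (p % 24 = 11 ∨ p % 24 = 13 →
      (∑ k ∈ Finset.range (p / 4 + 1),
          (Nat.choose (4 * k) (2 * k) : ZMod p) / 64 ^ k) = -1) := by
  have hp2 : p ≠ 2 := by omega
  have hodd := (Fact.out : p.Prime).eq_two_or_odd.resolve_left hp2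
  have h2 : (2 : ZMod p) ≠ 0 := ZMod.two_ne_zero_of_ne_two hp2
  have h4 : (4 : ZMod p) ≠ 0 := by
    rw [show (4 : ZMod p) = 2 ^ 2 by norm_num]; exact pow_ne_zero _ h2
  have h16 : (16 : ZMod p) ≠ 0 := by
    rw [show (16 : ZMod p) = 2 ^ 4 by norm_num]; exact pow_ne_zero _ h2
  have h64 : (64 : ZMod p) ≠ 0 := by
    rw [show (64 : ZMod p) = 2 ^ 6 by norm_num]; exact pow_ne_zero _ h2
  have hn : p / 2 ≠ 0 := by omega
  have hn' : (p - 1) / 2 = p / 2 := by omega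
  have s16 := two_mul_sum_choose_four_mul hp2 h16 (x := 1) (by norm_num)
  have s4 := two_mul_sum_choose_four_mul hp2 h4 (x := 2) (by norm_num)
  have s64 := two_mul_sum_choose_four_mul hp2 h64 (x := 1 / 2) (by field_simp; norm_num)
  rw [show (1 : ZMod p) + 1 = 2 by norm_num, sub_self, zero_pow hn, add_zero] at s16
  rw [show (1 : ZMod p) + 2 = 3 by norm_num, show (1 : ZMod p) - 2 = -1 by norm_num,
    three_pow_half hp] at s4
  rw [show (1 : ZMod p) + 1 / 2 = 3 / 2 by field_simp; norm_num,
    show (1 : ZMod p) - 1 / 2 = 1 / 2 by field_simp; norm_num, div_pow, div_pow, one_pow,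
    three_pow_half hp, two_pow_half hp2] at s64
  refine ⟨mul_left_cancel₀ h2 ?_, fun h => mul_left_cancel₀ h2 ?_,
    fun h => mul_left_cancel₀ h2 ?_, fun h => mul_left_cancel₀ h2 ?_,
    fun h => mul_left_cancel₀ h2 ?_, fun h => mul_left_cancel₀ h2 ?_⟩
  · rw [s16, legendreSym.eq_pow]
    field_simp
    norm_num
  · rw [s4, legendreSym_three_of_mod_eq_one h, hn']
    push_cast
    ring
  · rw [s4, legendreSym_three_of_mod_eq_two h]
    push_cast
    ring
  all_goals rw [s64]
  · suffices (-1 : ZMod p) ^ (p / 2) * (legendreSym 3 p : ZMod p) = -1 by rw [this]; ring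
    rcases h with h | h | h | h
    · rw [Even.neg_one_pow (Nat.even_iff.2 (by omega)),
        legendreSym_three_of_mod_eq_two (by omega)]; simp
    · rw [Odd.neg_one_pow (Nat.odd_iff.2 (by omega)),
        legendreSym_three_of_mod_eq_one (by omega)]; simp
    · rw [Even.neg_one_pow (Nat.even_iff.2 (by omega)),
        legendreSym_three_of_mod_eq_two (by omega)]; simp
    · rw [Odd.neg_one_pow (Nat.odd_iff.2 (by omega)),
        legendreSym_three_of_mod_eq_one (by omega)]; simp
  · rw [if_pos (by omega)]
    rcases h with h | h
    · rw [Even.neg_one_pow (Nat.even_iff.2 (by omega)),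
        legendreSym_three_of_mod_eq_one (by omega)]; norm_num
    · rw [Odd.neg_one_pow (Nat.odd_iff.2 (by omega)),
        legendreSym_three_of_mod_eq_two (by omega)]; norm_num
  · rw [if_neg (by omega)]
    rcases h with h | h
    · rw [Odd.neg_one_pow (Nat.odd_iff.2 (by omega)),
        legendreSym_three_of_mod_eq_two (by omega)]; norm_num
    · rw [Even.neg_one_pow (Nat.even_iff.2 (by omega)),
        legendreSym_three_of_mod_eq_one (by omega)]; norm_num
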